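/- (Sharp Gehring lemma, n = 1, 1 < p < ∞.) Let 1 < p < ∞ and let w be a weight on ℝ with finite Reverse Hölder constant [w]_{RH_p}. Let ε > 0 be the root of the equation (1/(p−1))·log((p+ε−1)/ε) − log((p+ε)/(p+ε−1)) = (p/(p−1))·log [w]_{RH_p}. Then for every δ with 0 < δ < ε, the weight w belongs to RH_{p+δ}, i.e. [w]_{RH_{p+δ}} < ∞. -/

import Mathlib

open MeasureTheory Real

/-- The average `⟨f⟩_{(a,b)} = (b-a)⁻¹ ∫_a^b f` of a function over a bounded interval. -/
noncomputable def intAvg (f : ℝ → ℝ) (a b : ℝ) : ℝ := (b - a)⁻¹ * ∫ t in a..b, f t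

theorem IsOpen.exists_connectedComponentIn_eq_Ioo {U : Set ℝ} (hU : IsOpen U)
    (hb : Bornology.IsBounded U) {x : ℝ} (hx : x ∈ U) :
    ∃ c d : ℝ, c < d ∧ c ∉ U ∧ d ∉ U ∧ connectedComponentIn U x = Set.Ioo c d := by
  set s := connectedComponentIn U x with hs
  have hsU : s ⊆ U := connectedComponentIn_subset U x
  have hxs : x ∈ s := mem_connectedComponentIn hx
  have hso : IsOpen s := hU.connectedComponentIn
  have hsb : Bornology.IsBounded s := hb.subset hsU
  have hbelow := hsb.bddBelow
  have habove := hsb.bddAbove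
  have hsub : Set.Ioo (sInf s) (sSup s) ⊆ s :=
    (isConnected_connectedComponentIn_iff.2 hx).Ioo_csInf_csSup_subset hbelow habove
  have hinf : sInf s ∉ s := fun h => by
    obtain ⟨l, hl, hls⟩ := exists_Ioc_subset_of_mem_nhds (hso.mem_nhds h) (exists_lt _)
    have := csInf_le hbelow (hls (show (l + sInf s) / 2 ∈ Set.Ioc l (sInf s) from
      ⟨by linarith, by linarith⟩))
    linarith
  have hsup : sSup s ∉ s := fun h => by
    obtain ⟨l, hl, hls⟩ := exists_Ico_subset_of_mem_nhds (hso.mem_nhds h) (exists_gt _)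
    have := le_csSup habove (hls (show (l + sSup s) / 2 ∈ Set.Ico (sSup s) l from
      ⟨by linarith, by linarith⟩))
    linarith
  have heq : s = Set.Ioo (sInf s) (sSup s) := by
    refine Set.Subset.antisymm (fun y hy => ⟨?_, ?_⟩) hsub
    · exact lt_of_le_of_ne (csInf_le hbelow hy) (fun h => hinf (h ▸ hy))
    · exact lt_of_le_of_ne (le_csSup habove hy) (fun h => hsup (h ▸ hy))
  have hxI : x ∈ Set.Ioo (sInf s) (sSup s) := heq ▸ hxs
  refine ⟨sInf s, sSup s, hxI.1.trans hxI.2, fun h => hinf ?_, fun h => hsup ?_, heq⟩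
  · refine (isPreconnected_Ico (a := sInf s) (b := sSup s)).subset_connectedComponentIn
      ⟨hxI.1.le, hxI.2⟩ (fun y hy => ?_) ⟨le_rfl, hxI.1.trans hxI.2⟩
    rcases hy.1.eq_or_lt with h1 | h1
    · exact h1 ▸ h
    · exact hsU (hsub ⟨h1, hy.2⟩)
  · refine (isPreconnected_Ioc (a := sInf s) (b := sSup s)).subset_connectedComponentIn
      ⟨hxI.1, hxI.2.le⟩ (fun y hy => ?_) ⟨hxI.1.trans hxI.2, le_rfl⟩
    rcases hy.2.eq_or_lt with h1 | h1
    · exact h1 ▸ h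
    · exact hsU (hsub ⟨hy.1, h1⟩)

theorem setIntegral_nonpos_of_forall_component {U : Set ℝ} (hU : IsOpen U)
    (hb : Bornology.IsBounded U) {φ : ℝ → ℝ} (hφ : IntegrableOn φ U)
    (h : ∀ c d : ℝ, c < d → c ∉ U → d ∉ U → Set.Ioo c d ⊆ U →
      ∫ x in Set.Ioo c d, φ x ≤ 0) :
    ∫ x in U, φ x ≤ 0 := by
  let S : Set (Set ℝ) := connectedComponentIn U '' U
  have hdisj : S.PairwiseDisjoint id := by
    rintro _ ⟨x, hx, rfl⟩ _ ⟨y, hy, rfl⟩ hne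
    refine Set.disjoint_left.2 fun z hz1 hz2 => hne ?_
    rw [connectedComponentIn_eq hz1, connectedComponentIn_eq hz2]
  have hcount : S.Countable := by
    refine hdisj.countable_of_isOpen ?_ ?_
    · rintro _ ⟨x, hx, rfl⟩
      exact hU.connectedComponentIn
    · rintro _ ⟨x, hx, rfl⟩
      exact ⟨x, mem_connectedComponentIn hx⟩
  have hUS : U = ⋃ s : S, (s : Set ℝ) := by
    ext x
    simp only [Set.mem_iUnion]
    refine ⟨fun hx => ⟨⟨_, x, hx, rfl⟩, mem_connectedComponentIn hx⟩, ?_⟩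
    rintro ⟨⟨_, y, hy, rfl⟩, hx⟩
    exact connectedComponentIn_subset U y hx
  have : Countable S := hcount.to_subtype
  rw [hUS] at hφ
  rw [hUS, integral_iUnion _ _ hφ]
  · refine tsum_nonpos ?_
    rintro ⟨_, x, hx, rfl⟩
    obtain ⟨c, d, hcd, hc, hd, heq⟩ := hU.exists_connectedComponentIn_eq_Ioo hb hx
    simp only [heq]
    exact h c d hcd hc hd (heq ▸ connectedComponentIn_subset U x)
  · rintro ⟨_, x, hx, rfl⟩
    exact hU.connectedComponentIn.measurableSet
  · intro s t hst
    exact hdisj s.2 t.2 (fun h => hst (Subtype.ext h))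

/-- A form of the rising sun lemma: a component `(c, d)` of the set where `F` exceeds one of its
earlier values satisfies `F c = F d`. -/
theorem eq_of_Ioo_component_risingSun {F : ℝ → ℝ} (hF : Continuous F) {a b : ℝ}
    (hmin : ∀ x ∈ Set.Icc a b, F b ≤ F x) {c d : ℝ} (hcd : c < d)
    (hc : c ∉ {x ∈ Set.Ioo a b | ∃ y ∈ Set.Ico a x, F y < F x})
    (hd : d ∉ {x ∈ Set.Ioo a b | ∃ y ∈ Set.Ico a x, F y < F x})
    (hsub : Set.Ioo c d ⊆ {x ∈ Set.Ioo a b | ∃ y ∈ Set.Ico a x, F y < F x}) :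
    a ≤ c ∧ d ≤ b ∧ F c = F d := by
  obtain ⟨hac, hdb⟩ := (Set.Ioo_subset_Ioo_iff hcd).1 fun x hx => (hsub hx).1
  have hdmin : ∀ y ∈ Set.Icc a d, F d ≤ F y := by
    intro y hy
    rcases hdb.eq_or_lt with rfl | hdb
    · exact hmin y hy
    rcases hy.2.eq_or_lt with rfl | hyd
    · exact le_rfl
    by_contra! hlt
    exact hd ⟨⟨hac.trans_lt hcd, hdb⟩, y, ⟨hy.1, hyd⟩, hlt⟩
  have hcmin : ∀ y ∈ Set.Icc a c, F c ≤ F y := by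
    intro y hy
    rcases hy.2.eq_or_lt with rfl | hyc
    · exact le_rfl
    by_contra! hlt
    exact hc ⟨⟨hy.1.trans_lt hyc, hcd.trans_le hdb⟩, y, ⟨hy.1, hyc⟩, hlt⟩
  refine ⟨hac, hdb, le_antisymm ?_ (hdmin c ⟨hac, hcd.le⟩)⟩
  have hle : ∀ x ∈ Set.Ioo c d, F c ≤ F x := by
    intro x hx
    obtain ⟨y, hy, hymin⟩ := isCompact_Icc.exists_isMinOn (s := Set.Icc a x)
      ⟨a, le_rfl, hac.trans hx.1.le⟩ hF.continuousOn
    refine le_trans ?_ (hymin (Set.right_mem_Icc.2 (hac.trans hx.1.le)))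
    rcases le_or_gt y c with hyc | hyc
    · exact hcmin y ⟨hy.1, hyc⟩
    · obtain ⟨-, z, hz, hzy⟩ := hsub ⟨hyc, hy.2.trans_lt hx.2⟩
      exact absurd hzy (not_lt.2 (hymin (show z ∈ Set.Icc a x from ⟨hz.1, hz.2.le.trans hy.2⟩)))
  exact ge_of_tendsto ((hF.tendsto d).mono_left nhdsWithin_le_nhds)
    (Filter.mem_of_superset (Ioo_mem_nhdsLT hcd) hle)

theorem isOpen_risingSun {F : ℝ → ℝ} (hF : Continuous F) (a b : ℝ) :
    IsOpen {x ∈ Set.Ioo a b | ∃ y ∈ Set.Ico a x, F y < F x} := by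
  have : {x ∈ Set.Ioo a b | ∃ y ∈ Set.Ico a x, F y < F x} =
      ⋃ y ∈ Set.Ici a, Set.Ioo a b ∩ (Set.Ioi y ∩ {x | F y < F x}) := by
    ext x
    simp only [Set.mem_ofPred_eq, Set.mem_iUnion, Set.mem_inter_iff, Set.mem_Ioi, Set.mem_Ici,
      Set.mem_Ico, exists_prop]
    grind
  rw [this]
  exact isOpen_biUnion fun y _ => isOpen_Ioo.inter (isOpen_Ioi.inter
    (isOpen_lt continuous_const hF))

theorem MeasureTheory.LocallyIntegrable.intervalIntegrable_real {f : ℝ → ℝ}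
    (hf : LocallyIntegrable f) (a b : ℝ) : IntervalIntegrable f volume a b :=
  (hf.integrableOn_isCompact isCompact_uIcc).intervalIntegrable

theorem HasDerivAt.nonpos_of_forall_Ico_le {F : ℝ → ℝ} {a x f : ℝ} (hx : a < x)
    (hF : HasDerivAt F f x) (h : ∀ y ∈ Set.Ico a x, F x ≤ F y) : f ≤ 0 := by
  have hslope := (hasDerivAt_iff_tendsto_slope_left_right.1 hF).1
  refine le_of_tendsto hslope (Filter.mem_of_superset (Ioo_mem_nhdsLT hx) fun y hy => ?_)
  have h1 := h y ⟨hy.1.le, hy.2⟩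
  have h2 : y - x < 0 := sub_neg.2 hy.2
  simp only [Set.mem_ofPred_eq, slope_def_field]
  exact div_nonpos_of_nonneg_of_nonpos (sub_nonneg.2 h1) h2.le

/-- If `φ ≤ 0` wherever `f ≤ 0`, and `φ` has nonpositive integral over each interval on which `f`
has zero integral, then `φ` has nonpositive integral over each interval on which `f` does. -/
theorem integral_nonpos_of_integral_eq_zero_imp {f φ : ℝ → ℝ} (hf : LocallyIntegrable f)
    (hφ : LocallyIntegrable φ) {a b : ℝ} (hab : a ≤ b) (hfab : ∫ t in a..b, f t ≤ 0)
    (hbal : ∀ c d : ℝ, c < d → ∫ t in c..d, f t = 0 → ∫ t in c..d, φ t ≤ 0)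
    (hneg : ∀ᵐ t, f t ≤ 0 → φ t ≤ 0) :
    ∫ t in a..b, φ t ≤ 0 := by
  set F : ℝ → ℝ := fun x => ∫ t in a..x, f t with hFdef
  have hfi := LocallyIntegrable.intervalIntegrable_real hf
  have hφi := LocallyIntegrable.intervalIntegrable_real hφ
  have hF : Continuous F := intervalIntegral.continuous_primitive hfi a
  have hFsub : ∀ c d, F d - F c = ∫ t in c..d, f t := fun c d =>
    intervalIntegral.integral_interval_sub_left (hfi a d) (hfi a c)
  have hF0 : F a = 0 := by simp [hFdef]
  obtain ⟨e, he, heb, hmin⟩ : ∃ e ∈ Set.Icc a b, F e = F b ∧ ∀ x ∈ Set.Icc a e, F e ≤ F x := by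
    set T : Set ℝ := Set.Icc a b ∩ {x | F x ≤ F b} with hT
    have hTc : IsCompact T := isCompact_Icc.inter_right (isClosed_le hF continuous_const)
    obtain ⟨e, heT, hemin⟩ := hTc.exists_isLeast ⟨b, ⟨hab, le_rfl⟩, le_refl (F b)⟩
    have hlt : ∀ x ∈ Set.Ico a e, F b < F x := by
      intro x hx
      by_contra! hle
      exact absurd (hemin ⟨⟨hx.1, hx.2.le.trans heT.1.2⟩, hle⟩) (not_le.2 hx.2)
    have heb : F e = F b := by
      refine le_antisymm heT.2 ?_
      rcases heT.1.1.eq_or_lt with h | h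
      · rw [← h, hF0]; exact hfab
      · exact ge_of_tendsto ((hF.tendsto e).mono_left nhdsWithin_le_nhds)
          (Filter.mem_of_superset (Ioo_mem_nhdsLT h) fun x hx => (hlt x ⟨hx.1.le, hx.2⟩).le)
    refine ⟨e, heT.1, heb, fun x hx => ?_⟩
    rcases hx.2.eq_or_lt with rfl | h
    · exact le_rfl
    · exact heb.trans_le (hlt x ⟨hx.1, h⟩).le
  rw [← intervalIntegral.integral_add_adjacent_intervals (hφi a e) (hφi e b)]
  refine add_nonpos ?_ ?_
  swap
  · rcases he.2.eq_or_lt with rfl | h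
    · simp
    · exact hbal e b h (by rw [← hFsub, heb, sub_self])
  set U := {x ∈ Set.Ioo a e | ∃ y ∈ Set.Ico a x, F y < F x} with hU
  have hUo : IsOpen U := isOpen_risingSun hF a e
  have hUsub : U ⊆ Set.Ioo a e := fun x hx => hx.1
  have hφae : IntegrableOn φ (Set.Ioo a e) := by
    rw [← intervalIntegrable_iff_integrableOn_Ioo_of_le he.1]
    exact hφi a e
  rw [intervalIntegral.integral_of_le he.1, integral_Ioc_eq_integral_Ioo,
    ← Set.union_sdiff_cancel hUsub,
    setIntegral_union Set.disjoint_sdiff_right (measurableSet_Ioo.diff hUo.measurableSet)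
      (hφae.mono_set hUsub) (hφae.mono_set Set.sdiff_subset)]
  refine add_nonpos ?_ ?_
  · refine setIntegral_nonpos_of_forall_component hUo ((Metric.isBounded_Ioo a e).subset hUsub)
      (hφae.mono_set hUsub) fun c d hcd hc hd hsub => ?_
    obtain ⟨-, -, h⟩ := eq_of_Ioo_component_risingSun hF hmin hcd hc hd hsub
    rw [← integral_Ioc_eq_integral_Ioo, ← intervalIntegral.integral_of_le hcd.le]
    exact hbal c d hcd (by rw [← hFsub, h, sub_self])
  · refine setIntegral_nonpos_ae (measurableSet_Ioo.diff hUo.measurableSet) ?_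
    filter_upwards [hneg, LocallyIntegrable.ae_hasDerivAt_integral hf] with x hx hderiv hxm
    refine hx ((hderiv a).nonpos_of_forall_Ico_le hxm.1.1 fun y hy => ?_)
    by_contra! hlt
    exact hxm.2 ⟨hxm.1, y, hy, hlt⟩

/-- The function `y ↦ yᵖ - D - κ (y - 1)` on `y > θ`, extended by zero; the slope
`κ = (D - θᵖ) / (1 - θ)` makes the formula vanish at `y = θ`. -/
noncomputable def truncatedChord (p D θ y : ℝ) : ℝ :=
  if θ < y then y ^ p - D - (D - θ ^ p) / (1 - θ) * (y - 1) else 0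

theorem measurable_truncatedChord (p D θ : ℝ) : Measurable (truncatedChord p D θ) :=
  Measurable.ite measurableSet_Ioi (by fun_prop) measurable_const

theorem convexOn_rpow_sub_chord {p : ℝ} (hp : 1 ≤ p) (D κ : ℝ) :
    ConvexOn ℝ (Set.Ici 0) (fun y : ℝ => y ^ p - D - κ * (y - 1)) := by
  have h1 : ConvexOn ℝ (Set.Ici (0 : ℝ)) (fun y : ℝ => (κ - D) + (-κ) * y) := by
    refine ⟨convex_Ici 0, fun x _ y _ s t _ _ hst => le_of_eq ?_⟩
    simp only [smul_eq_mul]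
    linear_combination (D - κ) * hst
  refine ((convexOn_rpow hp).add h1).congr fun y _ => ?_
  simp only [Pi.add_apply]
  ring

theorem truncatedChord_nonpos {p D θ y : ℝ} (hp : 1 ≤ p) (hθ0 : 0 < θ) (hθ1 : θ < 1)
    (hD : 1 ≤ D) (hy : y ≤ 1) : truncatedChord p D θ y ≤ 0 := by
  unfold truncatedChord
  split_ifs with h
  swap
  · exact le_rfl
  have hθ : 1 - θ ≠ 0 := by linarith
  have hzero : θ ^ p - D - (D - θ ^ p) / (1 - θ) * (θ - 1) = 0 := by
    field_simp
    ring
  have := (convexOn_rpow_sub_chord hp D ((D - θ ^ p) / (1 - θ))).le_max_of_mem_Icc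
    (x := θ) (y := 1) (z := y) hθ0.le (Set.mem_Ici.2 zero_le_one) ⟨h.le, hy⟩
  refine this.trans (max_le hzero.le ?_)
  simp only [one_rpow]
  linarith

theorem truncatedChord_le {p D θ y : ℝ} (hp : 1 ≤ p) (hθ1 : θ < 1)
    (hD : 1 < D) (hy : 0 ≤ y) :
    truncatedChord p D θ y ≤ y ^ p - D - (D - θ ^ p) / (1 - θ) * (y - 1) := by
  unfold truncatedChord
  split_ifs with h
  · exact le_rfl
  by_contra! hneg
  have hθ : 1 - θ ≠ 0 := by linarith
  have hzero : θ ^ p - D - (D - θ ^ p) / (1 - θ) * (θ - 1) = 0 := by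
    field_simp
    ring
  have := (convexOn_rpow_sub_chord hp D ((D - θ ^ p) / (1 - θ))).le_max_of_mem_Icc
    (x := y) (y := 1) (z := θ) hy (Set.mem_Ici.2 zero_le_one) ⟨not_lt.1 h, hθ1.le⟩
  rw [hzero] at this
  refine absurd this (not_le.2 (max_lt hneg ?_))
  simp only [one_rpow]
  linarith

theorem abs_truncatedChord_le {p D θ y : ℝ} (hD : 0 ≤ D) (hθ1 : θ < 1)
    (hDθ : θ ^ p ≤ D) (hy : 0 ≤ y) :
    |truncatedChord p D θ y| ≤ y ^ p + D + (D - θ ^ p) / (1 - θ) * (y + 1) := by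
  have hκ : 0 ≤ (D - θ ^ p) / (1 - θ) := div_nonneg (by linarith) (by linarith)
  have hyp : 0 ≤ y ^ p := rpow_nonneg hy p
  have h1 := mul_nonneg hκ hy
  unfold truncatedChord
  split_ifs with h
  · rw [abs_le]
    constructor <;> nlinarith
  · rw [abs_zero]
    nlinarith

theorem locallyIntegrable_rpow_div {p : ℝ} {w : ℝ → ℝ} (hpos : ∀ᵐ t, 0 < w t)
    (hwp : LocallyIntegrable (fun t => w t ^ p)) {l : ℝ} (hl : 0 < l) :
    LocallyIntegrable (fun t => (w t / l) ^ p) := by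
  refine (hwp.smul (l ^ p)⁻¹).congr ?_
  filter_upwards [hpos] with t ht
  simp only [Pi.smul_apply, smul_eq_mul]
  rw [div_rpow ht.le hl.le]
  ring

theorem MeasureTheory.LocallyIntegrable.truncatedChord_div {p D θ : ℝ} {w : ℝ → ℝ}
    (hw : LocallyIntegrable w) (hpos : ∀ᵐ t, 0 < w t)
    (hwp : LocallyIntegrable (fun t => w t ^ p))
    (hD : 0 ≤ D) (hθ1 : θ < 1) (hDθ : θ ^ p ≤ D) {l : ℝ} (hl : 0 < l) :
    LocallyIntegrable (fun t => truncatedChord p D θ (w t / l)) := by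
  have hbound : LocallyIntegrable
      (fun t => ((w t / l) ^ p + D) + (D - θ ^ p) / (1 - θ) * (w t / l + 1)) := by
    refine ((locallyIntegrable_rpow_div hpos hwp hl).add (locallyIntegrable_const D)).add ?_
    refine LocallyIntegrable.congr (((hw.smul l⁻¹).add (locallyIntegrable_const 1)).smul
      ((D - θ ^ p) / (1 - θ))) (Filter.Eventually.of_forall fun t => ?_)
    simp only [Pi.smul_apply, Pi.add_apply, smul_eq_mul]
    ring
  refine hbound.mono ?_ ?_
  · exact ((measurable_truncatedChord p D θ).comp_aemeasurable
      (hw.aestronglyMeasurable.aemeasurable.div_const l)).aestronglyMeasurable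
  · filter_upwards [hpos] with t ht
    rw [norm_eq_abs, norm_eq_abs]
    exact (abs_truncatedChord_le hD hθ1 hDθ (by positivity)).trans (le_abs_self _)

theorem integral_truncatedChord_nonpos {p D θ : ℝ} (hp : 1 ≤ p) {w : ℝ → ℝ}
    (hw : LocallyIntegrable w) (hpos : ∀ᵐ t, 0 < w t)
    (hwp : LocallyIntegrable (fun t => w t ^ p))
    (hθ0 : 0 < θ) (hθ1 : θ < 1) (hD : 1 < D)
    (hRH : ∀ c d l : ℝ, c < d → 0 < l → ∫ t in c..d, w t = l * (d - c) →
      ∫ t in c..d, w t ^ p ≤ D * l ^ p * (d - c))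
    {a b l : ℝ} (hab : a ≤ b) (hl : 0 < l) (hwab : ∫ t in a..b, w t ≤ l * (b - a)) :
    ∫ t in a..b, truncatedChord p D θ (w t / l) ≤ 0 := by
  have hDθ : θ ^ p ≤ D := (rpow_le_one hθ0.le hθ1.le (by linarith)).trans hD.le
  have hD0 : 0 ≤ D := by linarith
  have hwi := LocallyIntegrable.intervalIntegrable_real hw
  have hwpi := LocallyIntegrable.intervalIntegrable_real
    (locallyIntegrable_rpow_div hpos hwp hl)
  have hφ := hw.truncatedChord_div hpos hwp hD0 hθ1 hDθ hl
  have hfint : ∀ c d, ∫ t in c..d, (w t - l) = (∫ t in c..d, w t) - l * (d - c) := by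
    intro c d
    rw [intervalIntegral.integral_sub (hwi c d) intervalIntegrable_const,
      intervalIntegral.integral_const, smul_eq_mul, mul_comm]
  refine integral_nonpos_of_integral_eq_zero_imp (f := fun t => w t - l)
    (hw.sub (locallyIntegrable_const l)) hφ hab (by rw [hfint]; linarith) ?_ ?_
  · intro c d hcd h0
    rw [hfint, sub_eq_zero] at h0
    set κ := (D - θ ^ p) / (1 - θ) with hκ
    have hint1 : IntervalIntegrable (fun t => κ * (w t / l - 1)) volume c d :=
      (((hwi c d).div_const l).sub intervalIntegrable_const).const_mul κ
    have hint0 : IntervalIntegrable (fun t => (w t / l) ^ p - D) volume c d :=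
      (hwpi c d).sub intervalIntegrable_const
    calc ∫ t in c..d, truncatedChord p D θ (w t / l)
        ≤ ∫ t in c..d, ((w t / l) ^ p - D - κ * (w t / l - 1)) := by
          refine intervalIntegral.integral_mono_ae hcd.le
            (LocallyIntegrable.intervalIntegrable_real hφ c d) (hint0.sub hint1) ?_
          filter_upwards [hpos] with t ht
          exact truncatedChord_le hp hθ1 hD (by positivity)
      _ = (∫ t in c..d, w t ^ p) / l ^ p - D * (d - c) := by
          rw [intervalIntegral.integral_sub hint0 hint1,
            intervalIntegral.integral_sub (hwpi c d) intervalIntegrable_const,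
            intervalIntegral.integral_const_mul,
            intervalIntegral.integral_sub ((hwi c d).div_const l) intervalIntegrable_const,
            intervalIntegral.integral_div, h0, intervalIntegral.integral_const,
            intervalIntegral.integral_const]
          have : ∫ t in c..d, (w t / l) ^ p = (∫ t in c..d, w t ^ p) / l ^ p := by
            rw [← intervalIntegral.integral_div]
            refine intervalIntegral.integral_congr_ae ?_
            filter_upwards [hpos] with t ht _
            exact div_rpow ht.le hl.le p
          rw [this, smul_eq_mul, smul_eq_mul]
          field_simp
          ring
      _ ≤ 0 := by
          have hlp : 0 < l ^ p := rpow_pos_of_pos hl p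
          rw [sub_nonpos, div_le_iff₀ hlp]
          linarith [hRH c d l hcd hl h0]
  · refine Filter.Eventually.of_forall fun t ht => ?_
    exact truncatedChord_nonpos hp hθ0 hθ1 hD.le ((div_le_one hl).2 (by linarith))

theorem chord_weighted_primitive_lower {p q D y : ℝ} (hp : 1 < p) (hpq : p < q)
    (hc : 0 < ((q - 1) / q) ^ p / (q - p) - D / q) (hy : (q - 1) / q ≤ y) :
    ((q - 1) / q) ^ p / (q - p) - D / q ≤
      y ^ p / (q - p) - (D - q * (D - ((q - 1) / q) ^ p)) / q
        - q * (D - ((q - 1) / q) ^ p) * y / (q - 1) := by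
  have hq : 0 < q := by linarith
  have hq1 : 0 < q - 1 := by linarith
  have hqp : 0 < q - p := by linarith
  set θ := (q - 1) / q with hθ
  have hθ0 : 0 < θ := div_pos hq1 hq
  have hqθ : q - 1 = θ * q := by rw [hθ]; field_simp
  set T := θ ^ p with hT
  have hT0 : 0 < T := rpow_pos_of_pos hθ0 p
  have hbern : T * (1 + p * (y / θ - 1)) ≤ y ^ p := by
    have h1 := one_add_mul_self_le_rpow_one_add (s := y / θ - 1)
      (by linarith [div_nonneg (hθ0.le.trans hy) hθ0.le]) hp.le
    rw [add_sub_cancel, div_rpow (hθ0.le.trans hy) hθ0.le, le_div_iff₀ hT0] at h1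
    linarith
  have hslope : 0 ≤ p * T / (q - p) - (D - T) := by
    have h2 : D < T / (q - p) * q := (div_lt_iff₀ hq).1 (sub_pos.1 hc)
    have h3 : T / (q - p) * q - T = p * T / (q - p) := by
      field_simp
      ring
    linarith
  have hmain := mul_nonneg (sub_nonneg.2 hy) (div_nonneg hslope hθ0.le)
  have hdiv := div_le_div_of_nonneg_right hbern hqp.le
  refine le_trans ?_ (sub_le_sub_right (sub_le_sub_right hdiv _) _)
  rw [← sub_nonneg]
  refine hmain.trans_eq ?_
  rw [hqθ]
  field_simp
  ring

theorem integral_rpow_mul_chord {p q D κ x L m : ℝ} (hp : 1 < p) (hpq : p < q) (hx : 0 ≤ x)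
    (hL : 0 < L) (hLm : L ≤ m) :
    ∫ s in L..m, s ^ (q - 1) * ((x / s) ^ p - D - κ * (x / s - 1)) =
      (x ^ p * m ^ (q - p) / (q - p) - (D - κ) * m ^ q / q - κ * x * m ^ (q - 1) / (q - 1)) -
      (x ^ p * L ^ (q - p) / (q - p) - (D - κ) * L ^ q / q - κ * x * L ^ (q - 1) / (q - 1)) := by
  have hcongr : ∫ s in L..m, s ^ (q - 1) * ((x / s) ^ p - D - κ * (x / s - 1)) =
      ∫ s in L..m, (x ^ p * s ^ (q - p - 1) - (D - κ) * s ^ (q - 1) - κ * x * s ^ (q - 2)) := by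
    refine intervalIntegral.integral_congr fun s hs => ?_
    rw [Set.uIcc_of_le hLm] at hs
    have hs0 : 0 < s := hL.trans_le hs.1
    have h1 : s ^ (q - p - 1) = s ^ (q - 1) / s ^ p := by
      rw [← rpow_sub hs0]; congr 1; ring
    have h2 : s ^ (q - 2) = s ^ (q - 1) / s := by
      rw [← rpow_sub_one hs0.ne']; congr 1; ring
    rw [h1, h2, div_rpow hx hs0.le]
    ring
  have hint : ∀ r : ℝ, -1 < r → IntervalIntegrable (fun s : ℝ => s ^ r) volume L m :=
    fun r hr => intervalIntegral.intervalIntegrable_rpow' hr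
  have h1 := (hint (q - p - 1) (by linarith)).const_mul (x ^ p)
  have h2 := (hint (q - 1) (by linarith)).const_mul (D - κ)
  have h3 := (hint (q - 2) (by linarith)).const_mul (κ * x)
  rw [hcongr, intervalIntegral.integral_sub (h1.sub h2) h3, intervalIntegral.integral_sub h1 h2,
    intervalIntegral.integral_const_mul, intervalIntegral.integral_const_mul,
    intervalIntegral.integral_const_mul, integral_rpow (Or.inl (by linarith)),
    integral_rpow (Or.inl (by linarith)), integral_rpow (Or.inl (by linarith)),
    show q - p - 1 + 1 = q - p by ring, show q - 1 + 1 = q by ring,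
    show q - 2 + 1 = q - 1 by ring]
  ring

theorem le_integral_rpow_mul_truncatedChord {p q D x L Λ : ℝ} (hp : 1 < p) (hpq : p < q)
    (hD : 1 ≤ D) (hc : 0 < ((q - 1) / q) ^ p / (q - p) - D / q) (hx : 0 ≤ x)
    (hL : 0 < L) (hLΛ : L ≤ Λ) :
    (((q - 1) / q) ^ p / (q - p) - D / q) * min (x / ((q - 1) / q)) Λ ^ q -
      (x ^ p * L ^ (q - p) / (q - p) +
        (D - ((q - 1) / q) ^ p + (((q - 1) / q) ^ p / (q - p) - D / q)) * L ^ q) ≤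
      ∫ s in L..Λ, s ^ (q - 1) * truncatedChord p D ((q - 1) / q) (x / s) := by
  have hq : 0 < q := by linarith
  have hq1 : 0 < q - 1 := by linarith
  have hqp : 0 < q - p := by linarith
  have hlower := fun y : ℝ => chord_weighted_primitive_lower (y := y) hp hpq hc
  set θ := (q - 1) / q with hθ
  have hθ0 : 0 < θ := div_pos hq1 hq
  have hθ1 : θ ≤ 1 := (div_le_one hq).2 (by linarith)
  have hκ : (D - θ ^ p) / (1 - θ) = q * (D - θ ^ p) := by
    have : 1 - θ = 1 / q := by rw [hθ]; field_simp; ring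
    rw [this]; field_simp
  have hDθ : 0 ≤ D - θ ^ p := sub_nonneg.2 ((rpow_le_one hθ0.le hθ1 (by linarith)).trans hD)
  set c := θ ^ p / (q - p) - D / q with hcdef
  set κ := q * (D - θ ^ p) with hκdef
  have hκ0 : 0 ≤ κ := mul_nonneg hq.le hDθ
  have hLq : 0 < L ^ q := rpow_pos_of_pos hL q
  have hxL : 0 ≤ x ^ p * L ^ (q - p) / (q - p) :=
    div_nonneg (mul_nonneg (rpow_nonneg hx p) (rpow_nonneg hL.le _)) hqp.le
  rcases le_or_gt (x / θ) L with hxθ | hxθ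
  · have hzero : ∫ s in L..Λ, s ^ (q - 1) * truncatedChord p D θ (x / s) = 0 := by
      refine intervalIntegral.integral_zero_ae (Filter.Eventually.of_forall fun s hs => ?_)
      rw [Set.uIoc_of_le hLΛ] at hs
      have hs0 : 0 < s := hL.trans hs.1
      have : ¬ θ < x / s := by
        rw [not_lt, div_le_iff₀ hs0, mul_comm, ← div_le_iff₀ hθ0]
        exact hxθ.trans hs.1.le
      rw [truncatedChord, if_neg this, mul_zero]
    rw [hzero]
    have hmin : min (x / θ) Λ ^ q ≤ L ^ q :=
      rpow_le_rpow (le_min (by positivity) (hL.le.trans hLΛ)) ((min_le_left _ _).trans hxθ) hq.le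
    nlinarith [mul_le_mul_of_nonneg_left hmin hc.le, mul_nonneg hDθ hLq.le]
  set m := min (x / θ) Λ with hm
  have hLm : L ≤ m := le_min hxθ.le hLΛ
  have hm0 : 0 < m := hL.trans_le hLm
  have hmx : θ ≤ x / m := by
    rw [le_div_iff₀ hm0, mul_comm, ← le_div_iff₀ hθ0]
    exact min_le_left _ _
  have hcongr1 : ∀ᵐ s, s ∈ Set.uIoc L m → s ^ (q - 1) * ((x / s) ^ p - D - κ * (x / s - 1)) =
      s ^ (q - 1) * truncatedChord p D θ (x / s) := by
    filter_upwards [Measure.ae_ne volume m] with s hsm hs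
    rw [Set.uIoc_of_le hLm] at hs
    have hs0 : 0 < s := hL.trans hs.1
    have : θ < x / s := by
      rw [lt_div_iff₀ hs0, mul_comm, ← lt_div_iff₀ hθ0]
      exact (lt_of_le_of_ne hs.2 hsm).trans_le (min_le_left _ _)
    rw [truncatedChord, if_pos this, hκ]
  have hcongr2 : ∀ᵐ s, s ∈ Set.uIoc m Λ → s ^ (q - 1) * truncatedChord p D θ (x / s) = 0 := by
    refine Filter.Eventually.of_forall fun s hs => ?_
    rw [Set.uIoc_of_le (min_le_right _ _)] at hs
    have hs0 : 0 < s := hm0.trans hs.1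
    have hxs : x / θ ≤ s := by
      rcases min_choice (x / θ) Λ with h | h
      · rw [← h]; exact hs.1.le
      · exact absurd (hs.2.trans_eq (h.symm.trans hm.symm)) (not_le.2 hs.1)
    have : ¬ θ < x / s := by
      rw [not_lt, div_le_iff₀ hs0, mul_comm, ← div_le_iff₀ hθ0]
      exact hxs
    rw [truncatedChord, if_neg this, mul_zero]
  have hint1 : IntervalIntegrable (fun s => s ^ (q - 1) * truncatedChord p D θ (x / s))
      volume L m := by
    have : IntervalIntegrable (fun s => s ^ (q - 1) * ((x / s) ^ p - D - κ * (x / s - 1)))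
        volume L m := by
      refine ContinuousOn.intervalIntegrable fun s hs => ?_
      rw [Set.uIcc_of_le hLm] at hs
      have hs0 : s ≠ 0 := (hL.trans_le hs.1).ne'
      have hdiv : ContinuousAt (fun s => x / s) s := continuousAt_const.div continuousAt_id hs0
      exact (((continuousAt_id).rpow_const (Or.inr hq1.le)).mul
        (((hdiv.rpow_const (Or.inr (by linarith))).sub continuousAt_const).sub
          (continuousAt_const.mul (hdiv.sub continuousAt_const)))).continuousWithinAt
    exact this.congr_ae ((ae_restrict_iff' measurableSet_uIoc).2 hcongr1)
  have hint2 : IntervalIntegrable (fun s => s ^ (q - 1) * truncatedChord p D θ (x / s))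
      volume m Λ :=
    (intervalIntegrable_const (c := (0 : ℝ))).congr_ae ((ae_restrict_iff' measurableSet_uIoc).2
      (hcongr2.mono fun s h hs => (h hs).symm))
  rw [← intervalIntegral.integral_add_adjacent_intervals hint1 hint2,
    intervalIntegral.integral_zero_ae hcongr2, add_zero,
    ← intervalIntegral.integral_congr_ae hcongr1, integral_rpow_mul_chord hp hpq hx hL hLm]
  have hupper : c * m ^ q ≤
      x ^ p * m ^ (q - p) / (q - p) - (D - κ) * m ^ q / q - κ * x * m ^ (q - 1) / (q - 1) := by
    have h := mul_le_mul_of_nonneg_right (hlower (x / m) hmx) (rpow_pos_of_pos hm0 q).le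
    refine h.trans_eq ?_
    rw [div_rpow hx hm0.le, rpow_sub hm0, rpow_sub_one hm0.ne']
    have := (rpow_pos_of_pos hm0 p).ne'
    field_simp
  have hκq : κ * L ^ q / q = (D - θ ^ p) * L ^ q := by rw [hκdef]; field_simp
  have h1 : (D - κ) * L ^ q / q = D * L ^ q / q - κ * L ^ q / q := by ring
  have h2 : 0 ≤ κ * x * L ^ (q - 1) / (q - 1) :=
    div_nonneg (mul_nonneg (mul_nonneg hκ0 hx) (rpow_nonneg hL.le _)) hq1.le
  have h3 : 0 ≤ D * L ^ q / q := by positivity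
  have h4 := mul_nonneg hc.le hLq.le
  linarith

theorem integrable_rpow_mul_truncatedChord_prod {p q D θ : ℝ} (hp : 0 ≤ p) (hq : 1 ≤ q)
    (hD : 0 ≤ D) (hθ1 : θ < 1) (hDθ : θ ^ p ≤ D) {w : ℝ → ℝ} (hw : LocallyIntegrable w)
    (hpos : ∀ᵐ t, 0 < w t) (hwp : LocallyIntegrable (fun t => w t ^ p)) {a b L Λ : ℝ}
    (hL : 0 < L) (hLΛ : L ≤ Λ) :
    Integrable (Function.uncurry fun s t => s ^ (q - 1) * truncatedChord p D θ (w t / s))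
      ((volume.restrict (Set.uIoc L Λ)).prod (volume.restrict (Set.Ioc a b))) := by
  set κ := (D - θ ^ p) / (1 - θ) with hκ
  have hκ0 : 0 ≤ κ := div_nonneg (by linarith) (by linarith)
  have hdom : Integrable (fun t => Λ ^ (q - 1) * ((w t / L) ^ p + D + κ * (w t / L + 1)))
      (volume.restrict (Set.Ioc a b)) := by
    have h1 : Integrable (fun t => (w t / L) ^ p) (volume.restrict (Set.Ioc a b)) :=
      ((locallyIntegrable_rpow_div hpos hwp hL).integrableOn_isCompact isCompact_Icc).mono_set
        Set.Ioc_subset_Icc_self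
    have h2 : Integrable w (volume.restrict (Set.Ioc a b)) :=
      (hw.integrableOn_isCompact isCompact_Icc).mono_set Set.Ioc_subset_Icc_self
    exact ((h1.add (integrable_const D)).add
      (((h2.div_const L).add (integrable_const 1)).const_mul κ)).const_mul _
  have : IsFiniteMeasure (volume.restrict (Set.uIoc L Λ)) := by
    rw [Set.uIoc_of_le hLΛ]
    infer_instance
  have hdom2 := hdom.comp_snd (volume.restrict (Set.uIoc L Λ))
  refine hdom2.mono ?_ ?_
  · refine AEMeasurable.aestronglyMeasurable ?_
    have hfst : AEMeasurable (fun z : ℝ × ℝ => z.1)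
        ((volume.restrict (Set.uIoc L Λ)).prod (volume.restrict (Set.Ioc a b))) :=
      measurable_fst.aemeasurable
    have hsnd : AEMeasurable (fun z : ℝ × ℝ => w z.2)
        ((volume.restrict (Set.uIoc L Λ)).prod (volume.restrict (Set.Ioc a b))) :=
      hw.aestronglyMeasurable.aemeasurable.restrict.comp_quasiMeasurePreserving
        Measure.quasiMeasurePreserving_snd
    exact (hfst.pow_const (q - 1)).mul
      ((measurable_truncatedChord p D θ).comp_aemeasurable (hsnd.div hfst))
  · have h1 : ∀ᵐ z ∂((volume.restrict (Set.uIoc L Λ)).prod (volume.restrict (Set.Ioc a b))),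
        z.1 ∈ Set.uIoc L Λ :=
      Measure.quasiMeasurePreserving_fst.ae (ae_restrict_mem measurableSet_uIoc)
    have h2 : ∀ᵐ z ∂((volume.restrict (Set.uIoc L Λ)).prod (volume.restrict (Set.Ioc a b))),
        0 < w z.2 :=
      Measure.quasiMeasurePreserving_snd.ae (ae_restrict_of_ae hpos)
    filter_upwards [h1, h2] with ⟨s, t⟩ hs ht
    simp only at hs ht
    rw [Set.uIoc_of_le hLΛ] at hs
    have hs0 : 0 < s := hL.trans hs.1
    have hdiv : w t / s ≤ w t / L := div_le_div_of_nonneg_left ht.le hL hs.1.le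
    have hdiv0 : 0 ≤ w t / s := by positivity
    simp only [Function.uncurry, norm_eq_abs]
    refine le_trans ?_ (le_abs_self _)
    rw [abs_mul, abs_of_nonneg (rpow_nonneg hs0.le _)]
    refine mul_le_mul (rpow_le_rpow hs0.le hs.2 (by linarith))
      ((abs_truncatedChord_le hD hθ1 hDθ hdiv0).trans ?_) (abs_nonneg _)
      (rpow_nonneg (hs0.le.trans hs.2) _)
    have := rpow_le_rpow hdiv0 hdiv hp
    gcongr

/-- The sharp higher integrability estimate for truncations of `w`. -/
theorem integral_min_rpow_le {p q D : ℝ} (hp : 1 < p) (hpq : p < q) (hD : 1 < D)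
    (hc : 0 < ((q - 1) / q) ^ p / (q - p) - D / q) {w : ℝ → ℝ}
    (hw : LocallyIntegrable w) (hpos : ∀ᵐ t, 0 < w t)
    (hwp : LocallyIntegrable (fun t => w t ^ p))
    (hRH : ∀ c d l : ℝ, c < d → 0 < l → ∫ t in c..d, w t = l * (d - c) →
      ∫ t in c..d, w t ^ p ≤ D * l ^ p * (d - c))
    {a b L Λ : ℝ} (hab : a < b) (hL : 0 < L) (hLΛ : L ≤ Λ)
    (hwab : ∫ t in a..b, w t = L * (b - a)) :
    (((q - 1) / q) ^ p / (q - p) - D / q) *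
      ∫ t in Set.Ioc a b, min (w t / ((q - 1) / q)) Λ ^ q ≤
      (D / (q - p) + (D - ((q - 1) / q) ^ p + (((q - 1) / q) ^ p / (q - p) - D / q))) *
        L ^ q * (b - a) := by
  have hq : 0 < q := by linarith
  have hqp : 0 < q - p := by linarith
  have hpoint := fun x (hx : 0 ≤ x) =>
    le_integral_rpow_mul_truncatedChord hp hpq hD.le hc hx hL hLΛ
  have hθ0 : 0 < (q - 1) / q := div_pos (by linarith) hq
  have hθ1 : (q - 1) / q < 1 := (div_lt_one hq).2 (by linarith)
  set θ := (q - 1) / q with hθ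
  have hDθ : θ ^ p ≤ D := (rpow_le_one hθ0.le hθ1.le (by linarith)).trans hD.le
  set c := θ ^ p / (q - p) - D / q with hcdef
  set B := D - θ ^ p + c with hB
  have hprod := integrable_rpow_mul_truncatedChord_prod (q := q) (by linarith) (by linarith)
    (by linarith) hθ1 hDθ hw hpos hwp (a := a) (b := b) hL hLΛ
  have hswap := intervalIntegral_integral_swap hprod
  have hnonpos : ∫ s in L..Λ, ∫ t in Set.Ioc a b, s ^ (q - 1) * truncatedChord p D θ (w t / s)
      ≤ 0 := by
    rw [intervalIntegral.integral_of_le hLΛ]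
    refine setIntegral_nonpos measurableSet_Ioc fun s hs => ?_
    have hs0 : 0 < s := hL.trans hs.1
    rw [integral_const_mul, ← intervalIntegral.integral_of_le hab.le]
    refine mul_nonpos_of_nonneg_of_nonpos (rpow_nonneg hs0.le _) ?_
    refine integral_truncatedChord_nonpos hp.le hw hpos hwp hθ0 hθ1 hD hRH hab.le hs0 ?_
    rw [hwab]
    exact mul_le_mul_of_nonneg_right hs.1.le (by linarith)
  rw [hswap] at hnonpos
  have hwpI : IntegrableOn (fun t => w t ^ p) (Set.Ioc a b) :=
    (hwp.integrableOn_isCompact isCompact_Icc).mono_set Set.Ioc_subset_Icc_self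
  have hminI : IntegrableOn (fun t => min (w t / θ) Λ ^ q) (Set.Ioc a b) := by
    refine Measure.integrableOn_of_bounded (M := Λ ^ q) (by simp) ?_ ?_
    · exact (((hw.aestronglyMeasurable.aemeasurable.div_const θ).min
        aemeasurable_const).pow_const q).aestronglyMeasurable
    · filter_upwards [ae_restrict_of_ae hpos] with t ht
      have h0 : 0 ≤ min (w t / θ) Λ := le_min (by positivity) (hL.le.trans hLΛ)
      rw [norm_eq_abs, abs_of_nonneg (rpow_nonneg h0 q)]
      exact rpow_le_rpow h0 (min_le_right _ _) hq.le
  have hconst : IntegrableOn (fun _ : ℝ => B * L ^ q) (Set.Ioc a b) := integrable_const _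
  have hwpI' := (hwpI.mul_const (L ^ (q - p))).div_const (q - p)
  have hsum : IntegrableOn (fun t => w t ^ p * L ^ (q - p) / (q - p) + B * L ^ q)
      (Set.Ioc a b) := hwpI'.add hconst
  have hle : ∫ t in Set.Ioc a b, (c * min (w t / θ) Λ ^ q -
      (w t ^ p * L ^ (q - p) / (q - p) + B * L ^ q)) ≤ 0 := by
    refine le_trans (setIntegral_mono_ae ((hminI.const_mul c).sub hsum) ?_ ?_)
      hnonpos
    · have := hprod.integral_prod_right
      simpa only [Function.uncurry, IntegrableOn, intervalIntegral.integral_of_le hLΛ,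
        Set.uIoc_of_le hLΛ] using this
    · filter_upwards [hpos] with t ht
      exact hpoint (w t) ht.le
  rw [integral_sub (hminI.const_mul c) hsum, integral_add hwpI' hconst,
    integral_const_mul, integral_div, integral_mul_const, setIntegral_const, smul_eq_mul,
    volume_real_Ioc_of_le hab.le] at hle
  have hRH' := hRH a b L hab hL hwab
  rw [intervalIntegral.integral_of_le hab.le] at hRH'
  have hLp : L ^ p * L ^ (q - p) = L ^ q := by rw [← rpow_add hL]; congr 1; ring
  have h5 : (∫ t in Set.Ioc a b, w t ^ p) * L ^ (q - p) / (q - p) ≤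
      D / (q - p) * L ^ q * (b - a) := by
    calc _ ≤ D * L ^ p * (b - a) * L ^ (q - p) / (q - p) := by gcongr
      _ = D / (q - p) * (L ^ p * L ^ (q - p)) * (b - a) := by ring
      _ = _ := by rw [hLp]
  linarith

theorem integrableOn_and_setIntegral_le_of_min {q M : ℝ} (hq : 0 < q) {v : ℝ → ℝ}
    (hv : AEMeasurable v) (hpos : ∀ᵐ t, 0 < v t) {a b L : ℝ} (hL : 0 < L)
    (hM : ∀ Λ, L ≤ Λ → ∫ t in Set.Ioc a b, min (v t) Λ ^ q ≤ M) :
    IntegrableOn (fun t => v t ^ q) (Set.Ioc a b) ∧ ∫ t in Set.Ioc a b, v t ^ q ≤ M := by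
  have hpos' : ∀ᵐ t ∂volume.restrict (Set.Ioc a b), 0 < v t := ae_restrict_of_ae hpos
  have hmeas : ∀ Λ : ℝ, AEMeasurable (fun t => min (v t) Λ ^ q)
      (volume.restrict (Set.Ioc a b)) :=
    fun Λ => (hv.restrict.min aemeasurable_const).pow_const q
  have hΛ : ∀ n : ℕ, L ≤ L + n := fun n => by simp
  have hlim : Filter.Tendsto
      (fun n : ℕ => ∫⁻ t in Set.Ioc a b, ENNReal.ofReal (min (v t) (L + n) ^ q))
      Filter.atTop (nhds (∫⁻ t in Set.Ioc a b, ENNReal.ofReal (v t ^ q))) := by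
    refine lintegral_tendsto_of_tendsto_of_monotone (fun n => (hmeas _).ennreal_ofReal) ?_ ?_
    · filter_upwards [hpos'] with t ht m n hmn
      refine ENNReal.ofReal_le_ofReal (rpow_le_rpow
        (le_min ht.le (hL.le.trans (hΛ m))) (min_le_min le_rfl ?_) hq.le)
      have : (m : ℝ) ≤ n := by exact_mod_cast hmn
      linarith
    · filter_upwards with t
      refine tendsto_const_nhds.congr' ?_
      obtain ⟨N, hN⟩ := exists_nat_ge (v t)
      filter_upwards [Filter.eventually_ge_atTop N] with n hn
      have : (N : ℝ) ≤ n := by exact_mod_cast hn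
      rw [min_eq_left (by linarith)]
  have hbound : ∫⁻ t in Set.Ioc a b, ENNReal.ofReal (v t ^ q) ≤ ENNReal.ofReal M := by
    refine le_of_tendsto' hlim fun n => ?_
    have h0 : 0 ≤ᵐ[volume.restrict (Set.Ioc a b)] fun t => min (v t) (L + n) ^ q := by
      filter_upwards [hpos'] with t ht
      exact rpow_nonneg (le_min ht.le (hL.le.trans (hΛ n))) q
    have hint : IntegrableOn (fun t => min (v t) (L + n) ^ q) (Set.Ioc a b) := by
      refine Measure.integrableOn_of_bounded (M := (L + n) ^ q) (by simp)
        ((hv.min aemeasurable_const).pow_const q).aestronglyMeasurable ?_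
      filter_upwards [hpos'] with t ht
      have h0 : 0 ≤ min (v t) (L + n) := le_min ht.le (hL.le.trans (hΛ n))
      rw [norm_eq_abs, abs_of_nonneg (rpow_nonneg h0 q)]
      exact rpow_le_rpow h0 (min_le_right _ _) hq.le
    rw [← ofReal_integral_eq_lintegral_ofReal hint h0]
    exact ENNReal.ofReal_le_ofReal (hM _ (hΛ n))
  have h0 : 0 ≤ᵐ[volume.restrict (Set.Ioc a b)] fun t => v t ^ q := by
    filter_upwards [hpos'] with t ht
    exact rpow_nonneg ht.le q
  have hint : IntegrableOn (fun t => v t ^ q) (Set.Ioc a b) :=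
    ⟨(hv.restrict.pow_const q).aestronglyMeasurable,
      (hasFiniteIntegral_iff_ofReal h0).2 (hbound.trans_lt ENNReal.ofReal_lt_top)⟩
  refine ⟨hint, ?_⟩
  rw [← ofReal_integral_eq_lintegral_ofReal hint h0] at hbound
  have hM0 : 0 ≤ M := by
    refine le_trans ?_ (hM L le_rfl)
    refine integral_nonneg_of_ae ?_
    filter_upwards [hpos'] with t ht
    exact rpow_nonneg (le_min ht.le hL.le) q
  exact (ENNReal.ofReal_le_ofReal_iff hM0).1 hbound

theorem one_lt_of_eq_critical {p r D : ℝ} (hp : 1 < p) (hpr : p < r)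
    (hD : D = ((r - 1) / r) ^ p * r / (r - p)) : 1 < D := by
  have hr : 0 < r := by linarith
  have hrp : 0 < r - p := by linarith
  have h := one_add_mul_self_lt_rpow_one_add (s := -(1 / r))
    (neg_le_neg ((div_le_one hr).2 (by linarith))) (neg_ne_zero.2 (by positivity)) hp
  have h1 : 1 + -(1 / r) = (r - 1) / r := by field_simp; ring
  rw [h1] at h
  rw [hD, lt_div_iff₀ hrp]
  calc 1 * (r - p) = (1 + p * -(1 / r)) * r := by field_simp; ring
    _ < _ := mul_lt_mul_of_pos_right h hr

theorem critical_exponent_gap_pos {p q r D : ℝ} (hp : 1 < p) (hpq : p < q) (hqr : q < r)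
    (hD : D = ((r - 1) / r) ^ p * r / (r - p)) :
    0 < ((q - 1) / q) ^ p / (q - p) - D / q := by
  have hq : 0 < q := by linarith
  have hr : 0 < r := by linarith
  have hr1 : 0 < r - 1 := by linarith
  have hrp : 0 < r - p := by linarith
  have hqp : 0 < q - p := by linarith
  have hθ : 0 < (r - 1) / r := div_pos hr1 hr
  have hθq : 0 < (q - 1) / q := div_pos (by linarith) hq
  have hbern := one_add_mul_self_le_rpow_one_add (s := (q - 1) / q / ((r - 1) / r) - 1)
    (by linarith [div_pos hθq hθ]) hp.le
  rw [add_sub_cancel, div_rpow hθq.le hθ.le, le_div_iff₀ (rpow_pos_of_pos hθ p)] at hbern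
  have hT : 0 < ((r - 1) / r) ^ p := rpow_pos_of_pos hθ p
  set T := ((r - 1) / r) ^ p with hTdef
  rw [sub_pos, hD]
  refine lt_of_lt_of_le ?_ (div_le_div_of_nonneg_right hbern hqp.le)
  rw [← sub_pos]
  have : (1 + p * ((q - 1) / q / ((r - 1) / r) - 1)) * T / (q - p) - T * r / (r - p) / q =
      T * (p * (r - q) * (p - 1)) / ((r - 1) * (r - p) * (q - p) * q) := by
    field_simp
    ring
  rw [this]
  have h1 : 0 < r - q := by linarith
  have h2 : 0 < p - 1 := by linarith
  positivity

theorem rpow_eq_critical {p ε C : ℝ} (hp : 1 < p) (hε : 0 < ε) (hC : 0 < C)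
    (heq : (1/(p-1)) * Real.log ((p+ε-1)/ε) - Real.log ((p+ε)/(p+ε-1))
      = (p/(p-1)) * Real.log C) :
    C ^ p = ((p + ε - 1) / (p + ε)) ^ p * (p + ε) / (p + ε - p) := by
  have hp1 : 0 < p - 1 := by linarith
  have h1 : 0 < p + ε - 1 := by linarith
  have h2 : 0 < p + ε := by linarith
  have h3 : 0 < (p + ε - 1) / (p + ε) := div_pos h1 h2
  rw [add_sub_cancel_left]
  refine log_injOn_pos (rpow_pos_of_pos hC p) (Set.mem_Ioi.2 (by positivity)) ?_
  rw [log_rpow hC, log_div (by positivity) hε.ne', log_mul (by positivity) h2.ne', log_rpow h3,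
    log_div h1.ne' h2.ne']
  rw [log_div h1.ne' hε.ne', log_div h2.ne' h1.ne'] at heq
  field_simp at heq
  linear_combination -heq

theorem intAvg_pos {f : ℝ → ℝ} (hf : LocallyIntegrable f) (hpos : ∀ᵐ t, 0 < f t) {a b : ℝ}
    (hab : a < b) : 0 < intAvg f a b := by
  refine mul_pos (inv_pos.2 (sub_pos.2 hab)) ?_
  rw [intervalIntegral.integral_pos_iff_support_of_nonneg_ae'
    (ae_restrict_of_ae (hpos.mono fun t ht => ht.le))
    (LocallyIntegrable.intervalIntegrable_real hf a b)]
  refine ⟨hab, ?_⟩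
  rw [Measure.measure_inter_eq_of_ae
      (show ∀ᵐ t, t ∈ Function.support f from hpos.mono fun t ht => ht.ne'),
    Real.volume_Ioc]
  exact ENNReal.ofReal_pos.2 (sub_pos.2 hab)

/-- **Sharp Gehring Lemma (`n = 1`, `1 < p < ∞`).**
Let `1 < p < ∞` and let `w` be a weight on `ℝ` whose Reverse Hölder constant
`[w]_{RH_p}` is bounded by `C`, i.e. `(⟨wᵖ⟩_J)^{1/p} ≤ C·⟨w⟩_J` for every bounded
interval `J` of positive length. Let `ε > 0` be the root of
`(1/(p−1))·log((p+ε−1)/ε) − log((p+ε)/(p+ε−1)) = (p/(p−1))·log C`.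
Then for every `0 < δ < ε` the weight `w` belongs to `RH_{p+δ}`:
there is a constant `K` with `(⟨w^{p+δ}⟩_J)^{1/(p+δ)} ≤ K·⟨w⟩_J` for every `J`. -/
theorem sharp_gehring_lemma
    (p : ℝ) (hp : 1 < p)
    (w : ℝ → ℝ) (hw : LocallyIntegrable w)
    (hpos : ∀ᵐ t ∂volume, 0 < w t)
    (hwp : LocallyIntegrable (fun t => w t ^ p))
    (C : ℝ)
    (hC : ∀ a b : ℝ, a < b →
      (intAvg (fun t => w t ^ p) a b) ^ (1/p) ≤ C * intAvg w a b)
    (ε : ℝ) (hε : 0 < ε)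
    (heq : (1/(p-1)) * Real.log ((p+ε-1)/ε) - Real.log ((p+ε)/(p+ε-1))
      = (p/(p-1)) * Real.log C) :
    ∀ δ : ℝ, 0 < δ → δ < ε →
      ∃ K : ℝ, ∀ a b : ℝ, a < b →
        IntegrableOn (fun t => w t ^ (p+δ)) (Set.Ioc a b) ∧
        (intAvg (fun t => w t ^ (p+δ)) a b) ^ (1/(p+δ)) ≤ K * intAvg w a b := by
  intro δ hδ hδε
  have hp0 : 0 < p := by linarith
  have hposp : ∀ᵐ t, 0 < w t ^ p := hpos.mono fun t ht => rpow_pos_of_pos ht p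
  have hC0 : 0 < C := by
    have h1 := rpow_pos_of_pos (intAvg_pos hwp hposp zero_lt_one) (1 / p)
    exact pos_of_mul_pos_left (h1.trans_le (hC 0 1 zero_lt_one))
      (intAvg_pos hw hpos zero_lt_one).le
  have hcrit := rpow_eq_critical hp hε hC0 heq
  have hRH : ∀ c d l : ℝ, c < d → 0 < l → ∫ t in c..d, w t = l * (d - c) →
      ∫ t in c..d, w t ^ p ≤ C ^ p * l ^ p * (d - c) := by
    intro c d l hcd hl hint
    have hdc : 0 < d - c := sub_pos.2 hcd
    have h := hC c d hcd
    have hl' : intAvg w c d = l := by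
      rw [intAvg, hint]
      field_simp
    rw [hl', one_div, rpow_inv_le_iff_of_pos (intAvg_pos hwp hposp hcd).le (by positivity) hp0,
      mul_rpow hC0.le hl.le, intAvg, inv_mul_le_iff₀ hdc] at h
    linarith
  set q := p + δ with hq
  have hpq : p < q := by linarith
  have hq0 : 0 < q := by linarith
  have hD := one_lt_of_eq_critical hp (by linarith) hcrit
  have hc := critical_exponent_gap_pos hp hpq (by linarith) hcrit
  have hθ : 0 < (q - 1) / q := div_pos (by linarith) hq0
  have hDθ : ((q - 1) / q) ^ p ≤ C ^ p :=
    (rpow_le_one hθ.le ((div_le_one hq0).2 (by linarith)) hp0.le).trans hD.le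
  set θ := (q - 1) / q with hθdef
  set D := C ^ p with hDdef
  set c := θ ^ p / (q - p) - D / q with hcdef
  set A := D / (q - p) + (D - θ ^ p + c) with hA
  have hA0 : 0 ≤ A := by
    have : 0 ≤ D / (q - p) := div_nonneg (by linarith) (by linarith)
    linarith
  refine ⟨(θ ^ q * (A / c)) ^ (1 / q), fun a b hab => ?_⟩
  have hba : 0 < b - a := sub_pos.2 hab
  have hL : 0 < intAvg w a b := intAvg_pos hw hpos hab
  have hLint : ∫ t in a..b, w t = intAvg w a b * (b - a) := by
    rw [intAvg]
    field_simp
  obtain ⟨hint, hle⟩ := integrableOn_and_setIntegral_le_of_min (q := q) (v := fun t => w t / θ)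
    (M := A / c * intAvg w a b ^ q * (b - a)) hq0
    (hw.aestronglyMeasurable.aemeasurable.div_const θ)
    (hpos.mono fun t ht => div_pos ht hθ) hL fun Λ hΛ => by
      have := integral_min_rpow_le hp hpq hD hc hw hpos hwp hRH hab hL hΛ hLint
      rw [mul_comm, ← le_div_iff₀ hc] at this
      exact this.trans_eq (by ring)
  have hscale : (fun t => θ ^ q * (w t / θ) ^ q) =ᵐ[volume.restrict (Set.Ioc a b)]
      fun t => w t ^ q := by
    filter_upwards [ae_restrict_of_ae hpos] with t ht
    rw [← mul_rpow hθ.le (by positivity), mul_div_cancel₀ _ hθ.ne']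
  refine ⟨(hint.const_mul (θ ^ q)).congr hscale, ?_⟩
  have havg0 : 0 ≤ intAvg (fun t => w t ^ q) a b := by
    refine mul_nonneg (inv_nonneg.2 hba.le) ?_
    refine intervalIntegral.integral_nonneg_of_ae hab.le ?_
    filter_upwards [hpos] with t ht
    exact rpow_nonneg ht.le q
  have havg : intAvg (fun t => w t ^ q) a b ≤ θ ^ q * (A / c) * intAvg w a b ^ q := by
    rw [intAvg, intervalIntegral.integral_of_le hab.le, ← integral_congr_ae hscale,
      integral_const_mul, inv_mul_le_iff₀ hba]
    calc _ ≤ θ ^ q * (A / c * intAvg w a b ^ q * (b - a)) := by gcongr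
      _ = _ := by ring
  have hK : 0 ≤ θ ^ q * (A / c) := by positivity
  calc _ ≤ (θ ^ q * (A / c) * intAvg w a b ^ q) ^ (1 / q) :=
        rpow_le_rpow havg0 havg (by positivity)
    _ = _ := by
        rw [mul_rpow hK (by positivity), one_div, rpow_rpow_inv hL.le hq0.ne']
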